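/- Let d ≥ 1 be an integer, R > 0, and let α be a real number with 2 − d < α < 4 − d. Then for every x ∈ ℝ^d with |x| ≤ R, ∫_{B_R} |x − y|^α (R² − |y|²)^{1 − (α+d)/2} dy = −[(α + d − 2) π^{(d/2)+1}] / [Γ(d/2) sin((α+d)π/2)] · (α |x|²/(2d) + R²/2). -/

import Mathlib

open MeasureTheory Real

open Set Metric Pointwise in
lemma toSphere_iso {d : ℕ} (L : EuclideanSpace ℝ (Fin d) ≃ₗᵢ[ℝ] EuclideanSpace ℝ (Fin d))
    (f : EuclideanSpace ℝ (Fin d) → ℝ) :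
    ∫ w : sphere (0 : EuclideanSpace ℝ (Fin d)) 1, f (L w)
      ∂((volume : Measure (EuclideanSpace ℝ (Fin d))).toSphere)
    = ∫ w : sphere (0 : EuclideanSpace ℝ (Fin d)) 1, f w
      ∂((volume : Measure (EuclideanSpace ℝ (Fin d))).toSphere) := by
  let T : sphere (0 : EuclideanSpace ℝ (Fin d)) 1 ≃ₜ sphere (0 : EuclideanSpace ℝ (Fin d)) 1 :=
    { toFun := fun w => ⟨L w, by simp⟩
      invFun := fun w => ⟨L.symm w, by simp⟩
      left_inv := fun w => by simp
      right_inv := fun w => by simp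
      continuous_toFun := by fun_prop
      continuous_invFun := by fun_prop }
  have hT : MeasurePreserving T ((volume : Measure (EuclideanSpace ℝ (Fin d))).toSphere)
      ((volume : Measure (EuclideanSpace ℝ (Fin d))).toSphere) := by
    refine ⟨T.measurable, ?_⟩
    ext s hs
    rw [Measure.map_apply T.measurable hs, Measure.toSphere_apply' _ (T.measurable hs),
      Measure.toSphere_apply' _ hs]
    congr 1
    conv_rhs => rw [← (L.measurePreserving).measure_preimage_emb
      L.toHomeomorph.measurableEmbedding]
    congr 1
    ext z
    simp only [Set.mem_smul, Set.mem_image, Set.mem_preimage]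
    constructor
    · rintro ⟨r, hr, _, ⟨w, hw, rfl⟩, rfl⟩
      exact ⟨r, hr, _, ⟨T w, hw, rfl⟩, by simp [T]⟩
    · rintro ⟨r, hr, _, ⟨w, hw, rfl⟩, h⟩
      refine ⟨r, hr, _, ⟨T.symm w, by simpa using hw, rfl⟩, ?_⟩
      apply L.injective
      rw [← h]
      simp [T]
  exact hT.integral_comp T.measurableEmbedding (fun w => f w)

open Set Metric in
lemma sphere_second {d : ℕ} (hd : 1 ≤ d) (x : EuclideanSpace ℝ (Fin d)) :
    ∫ w : sphere (0 : EuclideanSpace ℝ (Fin d)) 1, (inner ℝ x (w : EuclideanSpace ℝ (Fin d))) ^ 2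
      ∂((volume : Measure (EuclideanSpace ℝ (Fin d))).toSphere)
    = ‖x‖ ^ 2 / d * (volume : Measure (EuclideanSpace ℝ (Fin d))).toSphere.real univ := by
  set σ := (volume : Measure (EuclideanSpace ℝ (Fin d))).toSphere with hσ
  have key : ∀ i : Fin d, ∫ w : sphere (0 : EuclideanSpace ℝ (Fin d)) 1,
      (inner ℝ x (w : EuclideanSpace ℝ (Fin d))) ^ 2 ∂σ
      = ∫ w : sphere (0 : EuclideanSpace ℝ (Fin d)) 1,
        ‖x‖ ^ 2 * ((w : EuclideanSpace ℝ (Fin d)) i) ^ 2 ∂σ := by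
    intro i
    have hn : ‖x‖ = ‖(EuclideanSpace.single i ‖x‖ : EuclideanSpace ℝ (Fin d))‖ := by simp
    have h := Submodule.reflection_sub hn
    set L := (Submodule.span ℝ {x - EuclideanSpace.single i ‖x‖})ᗮ.reflection
    rw [← toSphere_iso L (fun w => ‖x‖ ^ 2 * (w i) ^ 2)]
    congr 1
    ext w
    rw [← L.inner_map_map, h]
    simp [EuclideanSpace.inner_single_left]
    ring
  have hint : ∀ i : Fin d, Integrable (fun w : sphere (0 : EuclideanSpace ℝ (Fin d)) 1 =>
        ‖x‖ ^ 2 * ((w : EuclideanSpace ℝ (Fin d)) i) ^ 2) σ := by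
    intro i
    apply Continuous.integrable_of_hasCompactSupport (by fun_prop)
    exact HasCompactSupport.of_compactSpace _
  have hs : (d : ℝ) * ∫ w : sphere (0 : EuclideanSpace ℝ (Fin d)) 1,
      (inner ℝ x (w : EuclideanSpace ℝ (Fin d))) ^ 2 ∂σ = ‖x‖ ^ 2 * σ.real univ := by
    calc _ = ∑ i : Fin d, ∫ w : sphere (0 : EuclideanSpace ℝ (Fin d)) 1,
      (inner ℝ x (w : EuclideanSpace ℝ (Fin d))) ^ 2 ∂σ := by simp
      _ = ∑ i : Fin d, ∫ w : sphere (0 : EuclideanSpace ℝ (Fin d)) 1,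
        ‖x‖ ^ 2 * ((w : EuclideanSpace ℝ (Fin d)) i) ^ 2 ∂σ := Finset.sum_congr rfl (fun i _ => key i)
      _ = ∫ w : sphere (0 : EuclideanSpace ℝ (Fin d)) 1,
        ∑ i, ‖x‖ ^ 2 * ((w : EuclideanSpace ℝ (Fin d)) i) ^ 2 ∂σ := by
          rw [integral_finsetSum _ (fun i _ => hint i)]
      _ = ∫ w : sphere (0 : EuclideanSpace ℝ (Fin d)) 1, ‖x‖ ^ 2 ∂σ := by
          congr 1; ext w
          rw [← Finset.mul_sum, ← EuclideanSpace.real_norm_sq_eq]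
          simp
      _ = _ := by simp [mul_comm]
  have : (d : ℝ) ≠ 0 := by positivity
  field_simp
  linarith

open Set Metric in
lemma sphere_odd {d : ℕ} (x : EuclideanSpace ℝ (Fin d)) (f : ℝ → ℝ) (hf : ∀ t, f (-t) = - f t) :
    ∫ w : sphere (0 : EuclideanSpace ℝ (Fin d)) 1, f (inner ℝ x (w : EuclideanSpace ℝ (Fin d)))
      ∂((volume : Measure (EuclideanSpace ℝ (Fin d))).toSphere) = 0 := by
  have := toSphere_iso (LinearIsometryEquiv.neg ℝ) 
    (fun w : EuclideanSpace ℝ (Fin d) => f (inner ℝ x w))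
  simp only [LinearIsometryEquiv.coe_neg, inner_neg_right, hf, integral_neg] at this
  linarith

open Set Metric in
lemma lintegral_polar {d : ℕ} (hd : 1 ≤ d) (f : EuclideanSpace ℝ (Fin d) → ENNReal)
    (hf : Measurable f) :
    ∫⁻ z, f z = ∫⁻ w : sphere (0 : EuclideanSpace ℝ (Fin d)) 1, (∫⁻ r in Ioi (0:ℝ),
      ENNReal.ofReal (r ^ (d - 1)) * f (r • (w : EuclideanSpace ℝ (Fin d))))
      ∂((volume : Measure (EuclideanSpace ℝ (Fin d))).toSphere) := by
  have : Nonempty (Fin d) := ⟨⟨0, hd⟩⟩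
  have hm : Measurable (fun p : sphere (0 : EuclideanSpace ℝ (Fin d)) 1 × Ioi (0:ℝ) => 
      f ((p.2 : ℝ) • (p.1 : EuclideanSpace ℝ (Fin d)))) := hf.comp (by fun_prop)
  calc ∫⁻ z, f z = ∫⁻ z in ({0}ᶜ : Set (EuclideanSpace ℝ (Fin d))), f z := by
        rw [restrict_compl_singleton]
    _ = ∫⁻ z : ({0}ᶜ : Set (EuclideanSpace ℝ (Fin d))), f z ∂(Measure.comap Subtype.val volume) := by
        rw [lintegral_subtype_comap (measurableSet_singleton _).compl]
    _ = ∫⁻ p, f ((p.2 : ℝ) • (p.1 : EuclideanSpace ℝ (Fin d))) 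
          ∂((volume : Measure (EuclideanSpace ℝ (Fin d))).toSphere.prod 
            (.volumeIoiPow (Module.finrank ℝ (EuclideanSpace ℝ (Fin d)) - 1))) := by
        rw [← (volume : Measure (EuclideanSpace ℝ (Fin d))).measurePreserving_homeomorphUnitSphereProd.lintegral_comp_emb
          (Homeomorph.measurableEmbedding _)]
        congr 1
        ext z
        have : ‖(z : EuclideanSpace ℝ (Fin d))‖ ≠ 0 := norm_ne_zero_iff.2 z.2
        simp [smul_smul, this]
    _ = _ := by
        rw [lintegral_prod _ hm.aemeasurable]
        congr 1
        ext w
        unfold Measure.volumeIoiPow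
        have hg : Measurable (fun y : Ioi (0:ℝ) => f ((y : ℝ) • (w : EuclideanSpace ℝ (Fin d)))) :=
          hf.comp (by fun_prop)
        rw [lintegral_withDensity_eq_lintegral_mul _ (by fun_prop) hg, ← lintegral_subtype_comap measurableSet_Ioi]
        simp

open Set in
lemma radial_mass (v q β : ℝ) (hq : 0 ≤ q) (hv : 0 ≤ v) :
    ∫⁻ r in Ioi (0:ℝ), {r : ℝ | r ^ 2 ≤ v * (q - 2 * (r * β))}.indicator (fun r => ENNReal.ofReal r) r
      = ENNReal.ofReal (v ^ 2 * β ^ 2 + v * q / 2 - v * β * √(v ^ 2 * β ^ 2 + v * q)) := by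
  have h0 : 0 ≤ v ^ 2 * β ^ 2 + v * q := by positivity
  set s := √(v ^ 2 * β ^ 2 + v * q) with hs
  have hs2 : s ^ 2 = v ^ 2 * β ^ 2 + v * q := Real.sq_sqrt h0
  have hs0 : 0 ≤ s := Real.sqrt_nonneg _
  have hle : |v * β| ≤ s := by
    apply Real.abs_le_sqrt
    nlinarith [mul_nonneg hv hq]
  obtain ⟨h1, h2⟩ := abs_le.1 hle
  have ha : 0 ≤ s - v * β := by linarith
  have hset : ∀ r ∈ Ioi (0:ℝ), {r : ℝ | r ^ 2 ≤ v * (q - 2 * (r * β))}.indicator (fun r => ENNReal.ofReal r) r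
      = (Iic (s - v * β)).indicator (fun r => ENNReal.ofReal r) r := by
    intro r hr
    have hr' : (0:ℝ) < r := hr
    have : r ^ 2 ≤ v * (q - 2 * (r * β)) ↔ r ≤ s - v * β := by
      constructor
      · intro h
        have : |r + v * β| ≤ s := by
          apply Real.abs_le_sqrt
          nlinarith
        linarith [(abs_le.1 this).2]
      · intro h
        nlinarith
    simp only [indicator, mem_ofPred_eq, mem_Iic, this]
  rw [setLIntegral_congr_fun measurableSet_Ioi hset, setLIntegral_indicator measurableSet_Iic,
    inter_comm, Ioi_inter_Iic, ← ofReal_integral_eq_lintegral_ofReal]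
  · rw [← intervalIntegral.integral_of_le ha, integral_id]
    congr 1
    nlinarith
  · exact (continuous_id.integrableOn_Icc).mono_set Ioc_subset_Icc_self
  · filter_upwards [ae_restrict_mem measurableSet_Ioc] with r hr
    exact hr.1.le

open Set Metric in
lemma ball_mass {d : ℕ} (hd : 1 ≤ d) (x : EuclideanSpace ℝ (Fin d)) (v q : ℝ) (hq : 0 ≤ q) (hv : 0 ≤ v) :
    ∫⁻ z in {z : EuclideanSpace ℝ (Fin d) | ‖z‖ ^ 2 ≤ v * (q - 2 * inner ℝ x z)},
      ENNReal.ofReal (‖z‖ ^ (2 - (d:ℝ))) =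
    ENNReal.ofReal ((volume : Measure (EuclideanSpace ℝ (Fin d))).toSphere.real univ
      * (v ^ 2 * ‖x‖ ^ 2 / d + v * q / 2)) := by
  have hA : MeasurableSet {z : EuclideanSpace ℝ (Fin d) | ‖z‖ ^ 2 ≤ v * (q - 2 * inner ℝ x z)} :=
    measurableSet_le (by fun_prop) (by fun_prop)
  rw [← lintegral_indicator hA, lintegral_polar hd _ (Measurable.indicator (by fun_prop) hA)]
  have : ∀ w : sphere (0 : EuclideanSpace ℝ (Fin d)) 1, (∫⁻ r in Ioi (0:ℝ),
      ENNReal.ofReal (r ^ (d - 1)) * {z : EuclideanSpace ℝ (Fin d) | ‖z‖ ^ 2 ≤ v * (q - 2 * inner ℝ x z)}.indicator 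
        (fun z => ENNReal.ofReal (‖z‖ ^ (2 - (d:ℝ)))) (r • (w : EuclideanSpace ℝ (Fin d))))
      = ENNReal.ofReal (v ^ 2 * (inner ℝ x (w : EuclideanSpace ℝ (Fin d))) ^ 2 + v * q / 2
        - v * (inner ℝ x (w : EuclideanSpace ℝ (Fin d))) *
          √(v ^ 2 * (inner ℝ x (w : EuclideanSpace ℝ (Fin d))) ^ 2 + v * q)) := by
    intro w
    rw [← radial_mass v q _ hq hv]
    apply setLIntegral_congr_fun measurableSet_Ioi
    intro r hr
    have hr' : (0:ℝ) < r := hr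
    have hn : ‖r • (w : EuclideanSpace ℝ (Fin d))‖ = r := by
      rw [norm_smul]; simp [abs_of_pos hr']
    simp only [indicator, mem_ofPred_eq, hn, inner_smul_right]
    split_ifs
    · rw [← ENNReal.ofReal_mul (by positivity), ← Real.rpow_natCast, ← Real.rpow_add hr']
      congr 1
      push_cast [hd]
      ring_nf
      simp
    · simp
  simp_rw [this]
  rw [← ofReal_integral_eq_lintegral_ofReal]
  · congr 1
    rw [integral_sub, integral_add, integral_const_mul, sphere_second hd,
      sphere_odd x (fun t => v * t * √(v ^ 2 * t ^ 2 + v * q))]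
    · simp
      ring
    · intro t
      simp
    all_goals
      apply Continuous.integrable_of_hasCompactSupport (by fun_prop)
      exact HasCompactSupport.of_compactSpace _
  · apply Continuous.integrable_of_hasCompactSupport (by fun_prop)
    exact HasCompactSupport.of_compactSpace _
  · refine Filter.Eventually.of_forall fun w => ?_
    simp only [Pi.zero_apply]
    set β : ℝ := inner ℝ x (w : EuclideanSpace ℝ (Fin d))
    have h0 : 0 ≤ v ^ 2 * β ^ 2 + v * q := by positivity
    nlinarith [Real.sq_sqrt h0, sq_nonneg (√(v ^ 2 * β ^ 2 + v * q) - v * β)]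

open Set Metric in
lemma mass_le {d : ℕ} (hd : 1 ≤ d) (R : ℝ) (x : EuclideanSpace ℝ (Fin d))
    (hx : ‖x‖ ≤ R) (v : ℝ) (hv : 0 ≤ v) (hv1 : v ≤ 1) :
    ∫⁻ y in ((fun y : EuclideanSpace ℝ (Fin d) => ‖x - y‖ ^ 2 / (R ^ 2 + ‖x‖ ^ 2 - 2 * inner ℝ x y)) ⁻¹' Iic v)
        ∩ closedBall 0 R,
      ENNReal.ofReal (‖x - y‖ ^ (2 - (d:ℝ))) =
    ENNReal.ofReal ((volume : Measure (EuclideanSpace ℝ (Fin d))).toSphere.real univ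
      * (v ^ 2 * ‖x‖ ^ 2 / d + v * (R ^ 2 - ‖x‖ ^ 2) / 2)) := by
  have hR : 0 ≤ R := (norm_nonneg x).trans hx
  have hq : 0 ≤ R ^ 2 - ‖x‖ ^ 2 := by nlinarith [norm_nonneg x]
  have hset : ((fun y : EuclideanSpace ℝ (Fin d) => ‖x - y‖ ^ 2 / (R ^ 2 + ‖x‖ ^ 2 - 2 * inner ℝ x y)) ⁻¹' Iic v)
        ∩ closedBall 0 R = (fun y => y - x) ⁻¹' {z : EuclideanSpace ℝ (Fin d) |
          ‖z‖ ^ 2 ≤ v * ((R ^ 2 - ‖x‖ ^ 2) - 2 * inner ℝ x z)} := by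
    ext y
    have e1 : ‖y - x‖ = ‖x - y‖ := norm_sub_rev _ _
    have e2 : (R ^ 2 - ‖x‖ ^ 2) - 2 * inner ℝ x (y - x) = R ^ 2 + ‖x‖ ^ 2 - 2 * inner ℝ x y := by
      rw [inner_sub_right, real_inner_self_eq_norm_sq]; ring
    have e3 : ‖x - y‖ ^ 2 = ‖x‖ ^ 2 - 2 * inner ℝ x y + ‖y‖ ^ 2 := norm_sub_sq_real x y
    simp only [mem_inter_iff, mem_preimage, mem_Iic, mem_closedBall_zero_iff, mem_ofPred_eq, e1, e2]
    set D := R ^ 2 + ‖x‖ ^ 2 - 2 * inner ℝ x y with hD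
    have hb : ‖y‖ ≤ R ↔ ‖x - y‖ ^ 2 ≤ D := by
      rw [← sq_le_sq₀ (norm_nonneg y) hR]
      constructor <;> intro h <;> linarith
    rw [hb]
    have hn := sq_nonneg ‖x - y‖
    constructor
    · rintro ⟨h1, h2⟩
      rcases (hn.trans h2).eq_or_lt with h | h
      · rw [← h] at h2 ⊢
        simpa using h2
      · exact (div_le_iff₀ h).1 h1
    · intro h
      have hD0 : 0 ≤ D := by
        by_contra hneg
        push Not at hneg
        have h3 : ‖x - y‖ ^ 2 = 0 := le_antisymm (h.trans (by nlinarith)) hn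
        have h4 : x - y = 0 := by simpa using h3
        have h5 : x = y := sub_eq_zero.1 h4
        rw [← h5, real_inner_self_eq_norm_sq] at hD
        linarith
      refine ⟨div_le_of_le_mul₀ hD0 hv h, h.trans ?_⟩
      nlinarith
  have hA : MeasurableSet {z : EuclideanSpace ℝ (Fin d) | ‖z‖ ^ 2 ≤ v * ((R ^ 2 - ‖x‖ ^ 2) - 2 * inner ℝ x z)} :=
    measurableSet_le (by fun_prop) (by fun_prop)
  rw [hset, ← ball_mass hd x v _ hq hv, ← lintegral_indicator hA,
    ← lintegral_indicator (hA.preimage (by fun_prop))]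
  conv_rhs => rw [← lintegral_sub_right_eq_self _ x]
  congr 1
  ext y
  simp only [indicator, mem_preimage, norm_sub_rev x y]

open Set Metric in
lemma map_eq {d : ℕ} (hd : 1 ≤ d) (R : ℝ) (x : EuclideanSpace ℝ (Fin d))
    (hx : ‖x‖ ≤ R) :
    Measure.map (fun y : EuclideanSpace ℝ (Fin d) => ‖x - y‖ ^ 2 / (R ^ 2 + ‖x‖ ^ 2 - 2 * inner ℝ x y))
      ((volume.restrict (closedBall 0 R)).withDensity
        (fun y => ENNReal.ofReal (‖x - y‖ ^ (2 - (d:ℝ))))) =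
    (volume.restrict (Ioc (0:ℝ) 1)).withDensity (fun v => ENNReal.ofReal (
      (volume : Measure (EuclideanSpace ℝ (Fin d))).toSphere.real univ *
        (2 * ‖x‖ ^ 2 / d * v + (R ^ 2 - ‖x‖ ^ 2) / 2))) := by
  have hR : 0 ≤ R := (norm_nonneg x).trans hx
  have hq : 0 ≤ R ^ 2 - ‖x‖ ^ 2 := by nlinarith [norm_nonneg x]
  set S := (volume : Measure (EuclideanSpace ℝ (Fin d))).toSphere.real univ
  have hS : 0 ≤ S := measureReal_nonneg
  set V := (fun y : EuclideanSpace ℝ (Fin d) => ‖x - y‖ ^ 2 / (R ^ 2 + ‖x‖ ^ 2 - 2 * inner ℝ x y)) with hV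
  have hVm : Measurable V := by fun_prop
  have hV01 : ∀ y ∈ closedBall (0 : EuclideanSpace ℝ (Fin d)) R, V y ∈ Icc (0:ℝ) 1 := by
    intro y hy
    have e3 : ‖x - y‖ ^ 2 = ‖x‖ ^ 2 - 2 * inner ℝ x y + ‖y‖ ^ 2 := norm_sub_sq_real x y
    have hy' : ‖y‖ ^ 2 ≤ R ^ 2 := by
      rw [sq_le_sq₀ (norm_nonneg y) hR]; simpa using hy
    have hn := sq_nonneg ‖x - y‖
    exact ⟨div_nonneg hn (by linarith), div_le_one_of_le₀ (by linarith) (by linarith)⟩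
  have hc : Continuous (fun v : ℝ => S * (2 * ‖x‖ ^ 2 / d * v + (R ^ 2 - ‖x‖ ^ 2) / 2)) := by fun_prop
  have hint : ∀ a b : ℝ, IntegrableOn (fun v : ℝ => S * (2 * ‖x‖ ^ 2 / d * v + (R ^ 2 - ‖x‖ ^ 2) / 2))
      (Ioc a b) := fun a b => hc.integrableOn_Icc.mono_set Ioc_subset_Icc_self
  have : IsFiniteMeasure ((volume.restrict (Ioc (0:ℝ) 1)).withDensity (fun v => ENNReal.ofReal (
      S * (2 * ‖x‖ ^ 2 / d * v + (R ^ 2 - ‖x‖ ^ 2) / 2)))) :=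
    isFiniteMeasure_withDensity_ofReal (hint 0 1).2
  symm
  apply Measure.ext_of_Iic
  intro a
  rw [Measure.map_apply hVm measurableSet_Iic, withDensity_apply _ measurableSet_Iic,
    withDensity_apply _ (hVm measurableSet_Iic), Measure.restrict_restrict measurableSet_Iic,
    Measure.restrict_restrict (hVm measurableSet_Iic)]
  rcases lt_or_ge a 0 with ha | ha
  · have h1 : Iic a ∩ Ioc (0:ℝ) 1 = ∅ := by
      ext v; simp only [mem_inter_iff, mem_Iic, mem_Ioc, mem_empty_iff_false, iff_false]
      rintro ⟨h, h', -⟩; linarith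
    have h2 : V ⁻¹' Iic a ∩ closedBall 0 R = ∅ := by
      ext y; simp only [mem_inter_iff, mem_preimage, mem_Iic, mem_empty_iff_false, iff_false]
      rintro ⟨h, h'⟩; linarith [(hV01 y h').1]
    rw [h1, h2]; simp
  · have h1 : Iic a ∩ Ioc (0:ℝ) 1 = Ioc 0 (min a 1) := by
      ext v; simp only [mem_inter_iff, mem_Iic, mem_Ioc, le_min_iff]; tauto
    have h2 : V ⁻¹' Iic a ∩ closedBall 0 R = V ⁻¹' Iic (min a 1) ∩ closedBall 0 R := by
      ext y; simp only [mem_inter_iff, mem_preimage, mem_Iic, le_min_iff]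
      exact ⟨fun h => ⟨⟨h.1, (hV01 y h.2).2⟩, h.2⟩, fun h => ⟨h.1.1, h.2⟩⟩
    have hm0 : 0 ≤ min a 1 := le_min ha zero_le_one
    rw [h1, h2, mass_le hd R x hx (min a 1) hm0 (min_le_right _ _),
      ← ofReal_integral_eq_lintegral_ofReal (hint _ _)]
    · congr 1
      rw [← intervalIntegral.integral_of_le hm0, intervalIntegral.integral_const_mul,
        intervalIntegral.integral_add, intervalIntegral.integral_const_mul, integral_id]
      · change _ = S * _
        simp only [intervalIntegral.integral_const, smul_eq_mul, sub_zero]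
        ring
      · exact Continuous.intervalIntegrable (by fun_prop) _ _
      · exact Continuous.intervalIntegrable (by fun_prop) _ _
    · filter_upwards [ae_restrict_mem measurableSet_Ioc] with r hr
      have := hr.1.le
      simp only [Pi.zero_apply]
      positivity

lemma beta_int (k j : ℝ) (hj : -1 < j) (hk1 : k < 1) :
    IntervalIntegrable (fun v : ℝ => v ^ j * (1 - v) ^ (-k)) volume 0 1 ∧
    ∫ v in (0:ℝ)..1, v ^ j * (1 - v) ^ (-k) =
      Real.Gamma (j + 1) * Real.Gamma (1 - k) / Real.Gamma (j + 2 - k) := by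
  have h1 : (0:ℝ) < ((j + 1 : ℝ) : ℂ).re := by simp; linarith
  have h2 : (0:ℝ) < ((1 - k : ℝ) : ℂ).re := by simp; linarith
  have hc := Complex.betaIntegral_convergent h1 h2
  have hval := Complex.betaIntegral_eq_Gamma_mul_div _ _ h1 h2
  have heq : ∀ v ∈ Set.uIcc (0:ℝ) 1, ((v:ℂ) ^ (((j + 1 : ℝ) : ℂ) - 1) * (1 - (v:ℂ)) ^ (((1 - k : ℝ) : ℂ) - 1))
      = ((v ^ j * (1 - v) ^ (-k) : ℝ) : ℂ) := by
    intro v hv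
    rw [Set.uIcc_of_le zero_le_one] at hv
    rw [Complex.ofReal_mul, Complex.ofReal_cpow hv.1, Complex.ofReal_cpow (by linarith [hv.2])]
    push_cast
    ring_nf
  constructor
  · have h3 : IntervalIntegrable (fun v : ℝ => ((v ^ j * (1 - v) ^ (-k) : ℝ) : ℂ)) volume 0 1 :=
      hc.congr (fun v hv => heq v (Set.uIoc_subset_uIcc hv))
    rw [intervalIntegrable_iff] at h3 ⊢
    simpa [IntegrableOn] using h3.re
  · rw [Complex.betaIntegral, intervalIntegral.integral_congr heq, intervalIntegral.integral_ofReal] at hval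
    rw [← Complex.ofReal_add, Complex.Gamma_ofReal, Complex.Gamma_ofReal, Complex.Gamma_ofReal] at hval
    have : j + 1 + (1 - k) = j + 2 - k := by ring
    rw [this] at hval
    exact_mod_cast hval

lemma sphere_area {d : ℕ} (hd : 1 ≤ d) :
    (volume : Measure (EuclideanSpace ℝ (Fin d))).toSphere.real Set.univ
      = 2 * Real.pi ^ ((d : ℝ) / 2) / Real.Gamma ((d : ℝ) / 2) := by
  have : Nonempty (Fin d) := ⟨⟨0, hd⟩⟩
  have hd0 : (0:ℝ) < d := by exact_mod_cast hd
  have hG : 0 < Real.Gamma ((d : ℝ) / 2) := Real.Gamma_pos_of_pos (by positivity)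
  have hpi : √Real.pi ^ d = Real.pi ^ ((d : ℝ) / 2) := by
    rw [Real.sqrt_eq_rpow, ← Real.rpow_natCast, ← Real.rpow_mul Real.pi_pos.le]
    ring_nf
  rw [Measure.toSphere_real_apply_univ, measureReal_def, EuclideanSpace.volume_ball]
  rw [Fintype.card_fin, hpi, Real.Gamma_add_one (by positivity)]
  rw [ENNReal.ofReal_one, one_pow, one_mul, ENNReal.toReal_ofReal (by positivity)]
  simp only [finrank_euclideanSpace, Fintype.card_fin]
  field_simp

/-- For `2 − d < α < 4 − d` and every `x` with `|x| ≤ R`,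
`∫_{B_R} |x−y|^α (R²−|y|²)^{1−(α+d)/2} dy
  = −[(α+d−2) π^{d/2+1}]/[Γ(d/2) sin((α+d)π/2)] · (α|x|²/(2d) + R²/2)`. -/
theorem stmt10 (d : ℕ) (hd : 1 ≤ d) (R : ℝ) (hR : 0 < R) (α : ℝ)
    (hα1 : 2 - (d : ℝ) < α) (hα2 : α < 4 - d)
    (x : EuclideanSpace ℝ (Fin d)) (hx : ‖x‖ ≤ R) :
    ∫ y in Metric.closedBall (0 : EuclideanSpace ℝ (Fin d)) R,
        ‖x - y‖ ^ α * (R ^ 2 - ‖y‖ ^ 2) ^ (1 - (α + d) / 2)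
      = -((α + d - 2) * Real.pi ^ ((d : ℝ) / 2 + 1) /
            (Real.Gamma ((d : ℝ) / 2) * Real.sin ((α + d) * Real.pi / 2))) *
          (α * ‖x‖ ^ 2 / (2 * d) + R ^ 2 / 2) := by
  have hd0 : (0:ℝ) < d := by exact_mod_cast hd
  have : Nonempty (Fin d) := ⟨⟨0, hd⟩⟩
  obtain ⟨k, hk⟩ : ∃ k : ℝ, k = (α + d) / 2 - 1 := ⟨_, rfl⟩
  have hk0 : 0 < k := by rw [hk]; linarith
  have hk1 : k < 1 := by rw [hk]; linarith
  have hα : α = 2 - d + 2 * k := by rw [hk]; ring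
  have hexp : 1 - (α + d) / 2 = -k := by rw [hk]; ring
  set S := (volume : Measure (EuclideanSpace ℝ (Fin d))).toSphere.real Set.univ with hS
  have hS0 : 0 ≤ S := measureReal_nonneg
  set q := R ^ 2 - ‖x‖ ^ 2 with hqd
  have hq : 0 ≤ q := by rw [hqd]; nlinarith [norm_nonneg x]
  have hmap := map_eq hd R x hx
  set V := (fun y : EuclideanSpace ℝ (Fin d) =>
    ‖x - y‖ ^ 2 / (R ^ 2 + ‖x‖ ^ 2 - 2 * inner ℝ x y)) with hV
  have hVm : Measurable V := by fun_prop
  have step1 : ∫ y in Metric.closedBall (0 : EuclideanSpace ℝ (Fin d)) R,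
        ‖x - y‖ ^ α * (R ^ 2 - ‖y‖ ^ 2) ^ (1 - (α + d) / 2)
      = ∫ y in Metric.closedBall (0 : EuclideanSpace ℝ (Fin d)) R,
        (ENNReal.ofReal (‖x - y‖ ^ (2 - (d:ℝ)))).toReal • ((V y) ^ k * (1 - V y) ^ (-k)) := by
    apply integral_congr_ae
    have hne : ∀ᵐ y ∂(volume.restrict (Metric.closedBall (0 : EuclideanSpace ℝ (Fin d)) R)), y ≠ x :=
      ae_restrict_of_ae (Measure.ae_ne volume x)
    filter_upwards [hne, ae_restrict_mem measurableSet_closedBall] with y hyx hy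
    have hy' : ‖y‖ ^ 2 ≤ R ^ 2 := by
      rw [sq_le_sq₀ (norm_nonneg y) hR.le]; simpa using hy
    have e3 : ‖x - y‖ ^ 2 = ‖x‖ ^ 2 - 2 * inner ℝ x y + ‖y‖ ^ 2 := norm_sub_sq_real x y
    have hn : 0 < ‖x - y‖ := norm_pos_iff.2 (sub_ne_zero.2 hyx.symm)
    have hn2 : 0 < ‖x - y‖ ^ 2 := by positivity
    have hD : 0 < R ^ 2 + ‖x‖ ^ 2 - 2 * inner ℝ x y := by linarith
    have h1V : 1 - V y = (R ^ 2 - ‖y‖ ^ 2) / (R ^ 2 + ‖x‖ ^ 2 - 2 * inner ℝ x y) := by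
      simp only [hV]
      field_simp
      linarith
    rw [ENNReal.toReal_ofReal (by positivity), smul_eq_mul, h1V, hexp]
    simp only [hV]
    rw [Real.div_rpow hn2.le hD.le, Real.div_rpow (by linarith) hD.le, Real.rpow_neg hD.le,
      hα, Real.rpow_add hn, Real.rpow_mul hn.le, Real.rpow_two]
    have : (R ^ 2 + ‖x‖ ^ 2 - 2 * inner ℝ x y) ^ k ≠ 0 := (Real.rpow_pos_of_pos hD _).ne'
    field_simp
  rw [step1, ← integral_withDensity_eq_integral_toReal_smul (by fun_prop) (by simp),
    ← integral_map (f := fun v : ℝ => v ^ k * (1 - v) ^ (-k)) hVm.aemeasurable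
      (Measurable.aestronglyMeasurable (by fun_prop)), hmap,
    integral_withDensity_eq_integral_toReal_smul (by fun_prop) (by simp)]
  have step2 : ∫ v in Set.Ioc (0:ℝ) 1,
      (ENNReal.ofReal (S * (2 * ‖x‖ ^ 2 / d * v + q / 2))).toReal • (v ^ k * (1 - v) ^ (-k))
      = ∫ v in (0:ℝ)..1, (S * (2 * ‖x‖ ^ 2 / d) * (v ^ (k + 1) * (1 - v) ^ (-k))
        + S * q / 2 * (v ^ k * (1 - v) ^ (-k))) := by
    rw [intervalIntegral.integral_of_le zero_le_one]
    apply setIntegral_congr_fun measurableSet_Ioc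
    intro v hv
    have hv0 : 0 < v := hv.1
    simp only
    rw [ENNReal.toReal_ofReal (by positivity), smul_eq_mul, Real.rpow_add_one hv0.ne']
    ring
  obtain ⟨i1, v1⟩ := beta_int k (k + 1) (by linarith) hk1
  obtain ⟨i2, v2⟩ := beta_int k k (by linarith) hk1
  rw [step2, intervalIntegral.integral_add (i1.const_mul _) (i2.const_mul _),
    intervalIntegral.integral_const_mul, intervalIntegral.integral_const_mul, v1, v2]
  have g1 : Real.Gamma (k + 1 + 2 - k) = 2 := by
    rw [show k + 1 + 2 - k = 2 + 1 by ring, Real.Gamma_add_one two_ne_zero, Real.Gamma_two]; simp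
  have g2 : Real.Gamma (k + 2 - k) = 1 := by
    rw [show k + 2 - k = 2 by ring, Real.Gamma_two]
  have g3 : Real.Gamma (k + 1 + 1) = (k + 1) * (k * Real.Gamma k) := by
    rw [Real.Gamma_add_one (by positivity), Real.Gamma_add_one hk0.ne']
  have g4 := Real.Gamma_mul_Gamma_one_sub k
  have hsin : 0 < Real.sin (Real.pi * k) := by
    apply Real.sin_pos_of_pos_of_lt_pi
    · positivity
    · nlinarith [Real.pi_pos]
  have hsin2 : Real.sin ((α + d) * Real.pi / 2) = - Real.sin (Real.pi * k) := by
    rw [← Real.sin_add_pi]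
    congr 1
    rw [hk]; ring
  have hG : 0 < Real.Gamma ((d : ℝ) / 2) := Real.Gamma_pos_of_pos (by positivity)
  rw [g1, g2, g3, Real.Gamma_add_one hk0.ne', hsin2, hS, sphere_area hd,
    Real.rpow_add_one Real.pi_pos.ne',
    show (k + 1) * (k * Real.Gamma k) * Real.Gamma (1 - k) / 2
      = (k + 1) * k * (Real.Gamma k * Real.Gamma (1 - k)) / 2 by ring,
    show k * Real.Gamma k * Real.Gamma (1 - k) / 1
      = k * (Real.Gamma k * Real.Gamma (1 - k)) by ring, g4, hα, hqd]
  field_simp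
  ring
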